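/- Let n ≥ 1 and let X ⊆ [0,1]^n be a nonempty closed set such that the rational points of X (points all of whose coordinates are rational) are dense in X. Then McN(X) is hopfian: every surjective MV-endomorphism of McN(X) is injective. (This is the concrete form of the statement that every finitely generated semisimple MV-algebra whose finite rank maximal ideals are dense in its maximal spectral space is hopfian.) -/

import Mathlib

open Set BigOperators

/-- The unit cube `[0,1]^n` as a subset of `Fin n → ℝ`. -/
def cube (n : ℕ) : Set (Fin n → ℝ) := Set.Icc 0 1

/-- An (affine) linear polynomial with integer coefficients. -/
def IsAffineZ {n : ℕ} (p : (Fin n → ℝ) → ℝ) : Prop :=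
  ∃ (m : ℤ) (c : Fin n → ℤ), ∀ x, p x = (m : ℝ) + ∑ i, (c i : ℝ) * x i

/-- A McNaughton function on `[0,1]^n`: continuous, `[0,1]`-valued, and agreeing at each
point of the cube with one of finitely many affine polynomials with integer coefficients. -/
def IsMcNaughton {n : ℕ} (f : (Fin n → ℝ) → ℝ) : Prop :=
  ContinuousOn f (cube n) ∧ (∀ x ∈ cube n, f x ∈ Set.Icc (0:ℝ) 1) ∧
  ∃ (u : ℕ) (p : Fin u → (Fin n → ℝ) → ℝ),
    (∀ j, IsAffineZ (p j)) ∧ ∀ x ∈ cube n, ∃ j, f x = p j x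

/-- `McN X`: restrictions to `X` of McNaughton functions on `[0,1]^n`. -/
def McN {n : ℕ} (X : Set (Fin n → ℝ)) : Set (↥X → ℝ) :=
  {g : ↥X → ℝ | ∃ f, IsMcNaughton (n := n) f ∧ ∀ x : X, g x = f x.1}

/-- Pointwise MV-negation `¬f = 1 - f`. -/
def mvNeg {α : Type*} (f : α → ℝ) : α → ℝ := fun x => 1 - f x

/-- Pointwise MV-sum `f ⊕ g = min(1, f + g)`. -/
def mvOplus {α : Type*} (f g : α → ℝ) : α → ℝ := fun x => min 1 (f x + g x)

/-- A point all of whose coordinates are rational. -/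
def IsRationalPoint {n : ℕ} (x : Fin n → ℝ) : Prop := ∀ i, ∃ q : ℚ, x i = (q : ℝ)

/-- An MV-endomorphism of `McN X`. -/
def IsMVEndo {n : ℕ} (X : Set (Fin n → ℝ)) (σ : (↥X → ℝ) → (↥X → ℝ)) : Prop :=
  Set.MapsTo σ (McN X) (McN X) ∧
  σ (fun _ => 0) = (fun _ => 0) ∧
  (∀ f ∈ McN X, σ (mvNeg f) = mvNeg (σ f)) ∧
  (∀ f ∈ McN X, ∀ g ∈ McN X, σ (mvOplus f g) = mvOplus (σ f) (σ g))

theorem IsMcNaughton.of_finite {n : ℕ} {f : (Fin n → ℝ) → ℝ} (hf : ContinuousOn f (cube n))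
    (hI : ∀ x ∈ cube n, f x ∈ Set.Icc (0 : ℝ) 1) {ι : Type} [Finite ι]
    (p : ι → (Fin n → ℝ) → ℝ) (hp : ∀ j, IsAffineZ (p j))
    (h : ∀ x ∈ cube n, ∃ j, f x = p j x) : IsMcNaughton f := by
  obtain ⟨u, ⟨e⟩⟩ := Finite.exists_equiv_fin ι
  refine ⟨hf, hI, u, fun j => p (e.symm j), fun j => hp _, fun x hx => ?_⟩
  obtain ⟨j, hj⟩ := h x hx
  exact ⟨e j, by simpa using hj⟩

theorem isAffineZ_const {n : ℕ} (m : ℤ) : IsAffineZ (fun _ : Fin n → ℝ => (m : ℝ)) :=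
  ⟨m, 0, by simp⟩

theorem isAffineZ_eval {n : ℕ} (i : Fin n) : IsAffineZ (fun x : Fin n → ℝ => x i) :=
  ⟨0, Pi.single i 1, fun x => by simp [Pi.single_apply]⟩

theorem IsAffineZ.add {n : ℕ} {p q : (Fin n → ℝ) → ℝ} (hp : IsAffineZ p) (hq : IsAffineZ q) :
    IsAffineZ (fun x => p x + q x) := by
  obtain ⟨m, c, h⟩ := hp
  obtain ⟨m', c', h'⟩ := hq
  refine ⟨m + m', c + c', fun x => ?_⟩
  simp only [h, h', Pi.add_apply, Int.cast_add, add_mul, Finset.sum_add_distrib]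
  ring

theorem IsAffineZ.neg {n : ℕ} {p : (Fin n → ℝ) → ℝ} (hp : IsAffineZ p) :
    IsAffineZ (fun x => 1 - p x) := by
  obtain ⟨m, c, h⟩ := hp
  refine ⟨1 - m, -c, fun x => ?_⟩
  simp only [h, Pi.neg_apply, Int.cast_neg, Int.cast_sub, neg_mul, Finset.sum_neg_distrib,
    Int.cast_one]
  ring

theorem IsMcNaughton.neg {n : ℕ} {f : (Fin n → ℝ) → ℝ} (hf : IsMcNaughton f) :
    IsMcNaughton (mvNeg f) := by
  obtain ⟨hc, hI, u, p, hp, h⟩ := hf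
  refine ⟨continuousOn_const.sub hc, fun x hx => ?_, u, fun j x => 1 - p j x,
    fun j => (hp j).neg, fun x hx => ?_⟩
  · have := hI x hx
    exact ⟨by simp [mvNeg, this.2], by simp [mvNeg, this.1]⟩
  · obtain ⟨j, hj⟩ := h x hx
    exact ⟨j, by simp [mvNeg, hj]⟩

theorem IsMcNaughton.oplus {n : ℕ} {f g : (Fin n → ℝ) → ℝ} (hf : IsMcNaughton f)
    (hg : IsMcNaughton g) : IsMcNaughton (mvOplus f g) := by
  obtain ⟨hc, hI, u, p, hp, h⟩ := hf
  obtain ⟨hc', hI', v, q, hq, h'⟩ := hg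
  refine .of_finite (ι := Option (Fin u × Fin v)) (continuousOn_const.inf (hc.add hc'))
    (fun x hx => ⟨le_min zero_le_one (add_nonneg (hI x hx).1 (hI' x hx).1), min_le_left _ _⟩)
    (fun j x => j.elim ((1 : ℤ) : ℝ) (fun k => p k.1 x + q k.2 x)) ?_ fun x hx => ?_
  · rintro (_ | ⟨j, k⟩)
    · exact isAffineZ_const 1
    · exact (hp j).add (hq k)
  · obtain ⟨j, hj⟩ := h x hx
    obtain ⟨k, hk⟩ := h' x hx
    rcases min_choice 1 (f x + g x) with e | e
    · exact ⟨none, by simp [mvOplus, e]⟩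
    · exact ⟨some (j, k), e.trans (by simp only [hj, hk, Option.elim])⟩

section McN

variable {n : ℕ} {X : Set (Fin n → ℝ)}

theorem zero_mem_McN : (fun _ => 0) ∈ McN X := by
  refine ⟨fun _ => 0, ⟨continuousOn_const, fun x _ => by simp, 1, fun _ _ => ((0 : ℤ) : ℝ),
    fun _ => isAffineZ_const 0, fun x _ => ⟨0, by simp⟩⟩, fun _ => rfl⟩

theorem coord_mem_McN (i : Fin n) : (fun x : X => x.1 i) ∈ McN X := by
  refine ⟨fun x => x i, ⟨(continuous_apply i).continuousOn, fun x hx => ⟨hx.1 i, hx.2 i⟩, 1,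
    fun _ x => x i, fun _ => isAffineZ_eval i, fun x _ => ⟨0, rfl⟩⟩, fun _ => rfl⟩

theorem mvNeg_mem_McN {f : X → ℝ} (hf : f ∈ McN X) : mvNeg f ∈ McN X := by
  obtain ⟨F, hF, h⟩ := hf
  exact ⟨mvNeg F, hF.neg, fun x => by simp [mvNeg, h]⟩

theorem mvOplus_mem_McN {f g : X → ℝ} (hf : f ∈ McN X) (hg : g ∈ McN X) :
    mvOplus f g ∈ McN X := by
  obtain ⟨F, hF, h⟩ := hf
  obtain ⟨G, hG, h'⟩ := hg
  exact ⟨mvOplus F G, hF.oplus hG, fun x => by simp [mvOplus, h, h']⟩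

theorem continuous_of_mem_McN (hX : X ⊆ cube n) {f : X → ℝ} (hf : f ∈ McN X) :
    Continuous f := by
  obtain ⟨F, hF, h⟩ := hf
  rw [show f = X.domRestrict F from funext h]
  exact (hF.1.mono hX).domRestrict

theorem mem_Icc_of_mem_McN (hX : X ⊆ cube n) {f : X → ℝ} (hf : f ∈ McN X) (x : X) :
    f x ∈ Set.Icc (0 : ℝ) 1 := by
  obtain ⟨F, hF, h⟩ := hf
  rw [h]
  exact hF.2.1 _ (hX x.2)

/-- McNaughton functions do not introduce new denominators. -/
theorem exists_int_mul_eq_of_mem_McN (hX : X ⊆ cube n) {f : X → ℝ} (hf : f ∈ McN X) (x : X)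
    (d : ℕ) (hx : ∀ i, ∃ z : ℤ, (d : ℝ) * x.1 i = z) : ∃ z : ℤ, (d : ℝ) * f x = z := by
  obtain ⟨F, ⟨-, -, u, p, hp, hF⟩, h⟩ := hf
  obtain ⟨j, hj⟩ := hF x.1 (hX x.2)
  obtain ⟨m, c, hc⟩ := hp j
  choose z hz using hx
  refine ⟨d * m + ∑ i, c i * z i, ?_⟩
  rw [h, hj, hc, mul_add, Finset.mul_sum]
  push_cast
  congr 1
  refine Finset.sum_congr rfl fun i _ => ?_
  rw [← hz]
  ring

/-- An MV-homomorphism from `McN X` to the standard MV-algebra `[0,1]`. -/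
structure IsMVChar (X : Set (Fin n → ℝ)) (h : (X → ℝ) → ℝ) : Prop where
  mem_Icc : ∀ f ∈ McN X, h f ∈ Set.Icc (0 : ℝ) 1
  map_zero : h (fun _ => 0) = 0
  map_neg : ∀ f ∈ McN X, h (mvNeg f) = 1 - h f
  map_oplus : ∀ f ∈ McN X, ∀ g ∈ McN X, h (mvOplus f g) = min 1 (h f + h g)

theorem IsMVEndo.isMVChar (hX : X ⊆ cube n) {σ : (X → ℝ) → (X → ℝ)} (hσ : IsMVEndo X σ)
    (x : X) : IsMVChar X (fun f => σ f x) where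
  mem_Icc f hf := mem_Icc_of_mem_McN hX (hσ.1 hf) x
  map_zero := by simp [hσ.2.1]
  map_neg f hf := by simp [hσ.2.2.1 f hf, mvNeg]
  map_oplus f hf g hg := by simp [hσ.2.2.2 f hf g hg, mvOplus]

namespace IsMVChar

variable {h : (X → ℝ) → ℝ}

theorem ne_zero_of_le (hX : X ⊆ cube n) (hh : IsMVChar X h) (N : ℕ) :
    ∀ f ∈ McN X, (∀ x, (1 / 2 : ℝ) ^ N ≤ f x) → h f ≠ 0 := by
  induction N with
  | zero =>
    intro f hf hle h0
    have : f = mvNeg (fun _ => 0) := by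
      funext x
      have := (mem_Icc_of_mem_McN hX hf x).2
      have := hle x
      simp only [pow_zero, mvNeg, sub_zero] at *
      linarith
    rw [this, hh.map_neg _ zero_mem_McN, hh.map_zero] at h0
    norm_num at h0
  | succ N ih =>
    intro f hf hle h0
    refine ih _ (mvOplus_mem_McN hf hf) (fun x => ?_) (by simp [hh.map_oplus f hf f hf, h0])
    have h1 := hle x
    rw [pow_succ] at h1
    exact le_min (pow_le_one₀ (by norm_num) (by norm_num)) (by linarith)

/-- By compactness, the kernel of a homomorphism to `[0,1]` has a common zero. -/
theorem exists_common_zero (hX : X ⊆ cube n) (hcl : IsClosed X) (hh : IsMVChar X h) :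
    ∃ x : X, ∀ f ∈ McN X, h f = 0 → f x = 0 := by
  by_contra! hcon
  have : CompactSpace X :=
    isCompact_iff_compactSpace.mp (isCompact_Icc.of_isClosed_subset hcl hX)
  obtain ⟨f, hf, h0, hpos⟩ : ∃ f ∈ McN X, h f = 0 ∧ ∀ x ∈ (Set.univ : Set X), 0 < f x := by
    refine isCompact_univ.induction_on (p := fun s => ∃ f ∈ McN X, h f = 0 ∧ ∀ x ∈ s, 0 < f x)
      ⟨_, zero_mem_McN, hh.map_zero, by simp⟩ ?_ ?_ ?_
    · rintro s t hst ⟨f, hf, h0, hp⟩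
      exact ⟨f, hf, h0, fun x hx => hp x (hst hx)⟩
    · rintro s t ⟨f, hf, h0, hp⟩ ⟨g, hg, h0', hp'⟩
      refine ⟨_, mvOplus_mem_McN hf hg, by simp [hh.map_oplus f hf g hg, h0, h0'], ?_⟩
      intro x hx
      have h1 := (mem_Icc_of_mem_McN hX hf x).1
      have h2 := (mem_Icc_of_mem_McN hX hg x).1
      refine lt_min one_pos ?_
      rcases hx with hx | hx
      · linarith [hp x hx]
      · linarith [hp' x hx]
    · intro x _
      obtain ⟨f, hf, h0, hne⟩ := hcon x
      have hx : 0 < f x := (mem_Icc_of_mem_McN hX hf x).1.lt_of_ne' hne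
      exact ⟨{y | 0 < f y}, mem_nhdsWithin_of_mem_nhds
        ((isOpen_lt continuous_const (continuous_of_mem_McN hX hf)).mem_nhds hx),
        f, hf, h0, fun _ hy => hy⟩
  rcases isEmpty_or_nonempty X with hE | hN
  · exact hh.ne_zero_of_le hX 0 f hf (fun x => hE.elim x) h0
  · obtain ⟨x₀, -, hx₀⟩ := isCompact_univ.exists_isMinOn Set.univ_nonempty
      (continuous_of_mem_McN hX hf).continuousOn
    obtain ⟨N, hN⟩ := exists_pow_lt_of_lt_one (hpos x₀ trivial) (by norm_num : (1 / 2 : ℝ) < 1)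
    exact hh.ne_zero_of_le hX N f hf (fun x => hN.le.trans (hx₀ (Set.mem_univ x))) h0

/-- Doubling `f ⊕ f` or `f ⊙ f` widens any gap between `h f` and `f x`. -/
theorem apply_sub_le (hX : X ⊆ cube n) (hh : IsMVChar X h) {x : X}
    (hx : ∀ f ∈ McN X, h f = 0 → f x = 0) (N : ℕ) :
    ∀ f ∈ McN X, f x - h f ≤ (1 / 2 : ℝ) ^ N := by
  induction N with
  | zero =>
    intro f hf
    have := (mem_Icc_of_mem_McN hX hf x).2
    have := (hh.mem_Icc f hf).1
    simp only [pow_zero]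
    linarith
  | succ N ih =>
    intro f hf
    have hn := mvNeg_mem_McN hf
    have hd := mvNeg_mem_McN (mvOplus_mem_McN hn hn)
    have e1 := hh.map_oplus f hf f hf
    have e2 : h (mvNeg (mvOplus (mvNeg f) (mvNeg f))) = 1 - min 1 ((1 - h f) + (1 - h f)) := by
      rw [hh.map_neg _ (mvOplus_mem_McN hn hn), hh.map_oplus _ hn _ hn, hh.map_neg f hf]
    have i1 := ih _ (mvOplus_mem_McN hf hf)
    have i2 := ih _ hd
    have z2 := hx _ hd
    rw [e1] at i1
    rw [e2] at i2 z2
    simp only [mvNeg, mvOplus] at i1 i2 z2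
    have hp : (0 : ℝ) < (1 / 2) ^ N := by positivity
    rw [pow_succ]
    by_contra! hlt
    rcases le_or_gt (f x) (1 / 2) with hv | hv
    · rw [min_eq_right (by linarith), min_eq_right (by linarith)] at i1
      linarith
    · rw [min_eq_right (a := (1 : ℝ)) (b := 1 - f x + (1 - f x)) (by linarith)] at i2 z2
      rcases le_or_gt (1 / 2) (h f) with hu | hu
      · rw [min_eq_right (by linarith)] at i2
        linarith
      · have := z2 (by rw [min_eq_left (by linarith)]; ring)
        linarith

/-- Every homomorphism from `McN X` to `[0,1]` is the evaluation at a point of `X`. -/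
theorem exists_eq_eval (hX : X ⊆ cube n) (hcl : IsClosed X) (hh : IsMVChar X h) :
    ∃ x : X, ∀ f ∈ McN X, h f = f x := by
  obtain ⟨x, hx⟩ := hh.exists_common_zero hX hcl
  have key : ∀ f ∈ McN X, f x ≤ h f := fun f hf => by
    have := ge_of_tendsto' (tendsto_pow_atTop_nhds_zero_of_lt_one (by norm_num)
      (by norm_num : (1 / 2 : ℝ) < 1)) (fun N => hh.apply_sub_le hX hx N f hf)
    linarith
  refine ⟨x, fun f hf => le_antisymm ?_ (key f hf)⟩
  have := key _ (mvNeg_mem_McN hf)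
  rw [hh.map_neg f hf, mvNeg] at this
  linarith

end IsMVChar

theorem finite_setOf_denominator (hX : X ⊆ cube n) {d : ℕ} (hd : 0 < d) :
    {x : X | ∀ i, ∃ z : ℤ, (d : ℝ) * x.1 i = z}.Finite := by
  have hd' : (0 : ℝ) < d := by exact_mod_cast hd
  have hfin : (Set.univ.pi fun _ : Fin n =>
      (fun z : ℤ => (z : ℝ) / d) '' Set.Icc 0 (d : ℤ)).Finite :=
    Set.Finite.pi fun _ => (Set.finite_Icc _ _).image _
  refine Set.Finite.of_finite_image (f := Subtype.val) (hfin.subset ?_)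
    Subtype.val_injective.injOn
  rintro _ ⟨x, hx, rfl⟩ i -
  obtain ⟨z, hz⟩ := hx i
  have h0 : 0 ≤ x.1 i := (hX x.2).1 i
  have h1 : x.1 i ≤ 1 := (hX x.2).2 i
  refine ⟨z, ⟨?_, ?_⟩, ?_⟩
  · have : (0 : ℝ) ≤ z := hz ▸ by positivity
    exact_mod_cast this
  · have : (z : ℝ) ≤ d := hz ▸ mul_le_of_le_one_right hd'.le h1
    exact_mod_cast this
  · simp only [← hz]
    field_simp

end McN

theorem IsRationalPoint.exists_denominator {n : ℕ} {x : Fin n → ℝ} (hx : IsRationalPoint x) :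
    ∃ d : ℕ, 0 < d ∧ ∀ i, ∃ z : ℤ, (d : ℝ) * x i = z := by
  choose q hq using hx
  refine ⟨∏ i, (q i).den, Finset.prod_pos fun i _ => (q i).den_pos, fun i => ?_⟩
  refine ⟨(∏ j ∈ Finset.univ.erase i, (q j).den : ℕ) * (q i).num, ?_⟩
  rw [← Finset.prod_erase_mul _ _ (Finset.mem_univ i), hq]
  have : ((q i).den : ℝ) * (q i : ℝ) = (q i).num := by exact_mod_cast Rat.den_mul_eq_num (q i)
  push_cast
  rw [mul_assoc, this]

/-- if `X ⊆ [0,1]^n` is nonempty, closed, and its rational points are dense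
in `X`, then `McN(X)` is hopfian: every surjective MV-endomorphism is injective. -/
theorem stmt1 {n : ℕ} (hn : 1 ≤ n) (X : Set (Fin n → ℝ)) (hXc : X ⊆ cube n)
    (hcl : IsClosed X) (hne : X.Nonempty)
    (hdense : X ⊆ closure {x ∈ X | IsRationalPoint x}) :
    ∀ σ : (↥X → ℝ) → (↥X → ℝ), IsMVEndo X σ →
      Set.SurjOn σ (McN X) (McN X) → Set.InjOn σ (McN X) := by
  intro σ hσ hsurj f hf g hg hfg
  choose η hη using fun x => (hσ.isMVChar hXc x).exists_eq_eval hXc hcl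
  have hinj : Function.Injective η := by
    intro x y hxy
    ext i
    obtain ⟨k, hk, hki⟩ := hsurj (coord_mem_McN i)
    have hx : σ k x = x.1 i := congrFun hki x
    have hy : σ k y = y.1 i := congrFun hki y
    rw [← hx, ← hy, hη x k hk, hη y k hk, hxy]
  have hrange : ∀ x : X, IsRationalPoint x.1 → ∃ y, η y = x := by
    intro x hx
    obtain ⟨d, hd, hxd⟩ := hx.exists_denominator
    have hmaps : Set.MapsTo η {x : X | ∀ i, ∃ z : ℤ, (d : ℝ) * x.1 i = z}
        {x : X | ∀ i, ∃ z : ℤ, (d : ℝ) * x.1 i = z} := by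
      intro y hy i
      have hc := coord_mem_McN (X := X) i
      rw [← hη y _ hc]
      exact exists_int_mul_eq_of_mem_McN hXc (hσ.1 hc) y d hy
    obtain ⟨y, -, hy⟩ := (((finite_setOf_denominator hXc hd).injOn_iff_bijOn_of_mapsTo
      hmaps).mp hinj.injOn).surjOn hxd
    exact ⟨y, hy⟩
  have hd : Dense {x : X | IsRationalPoint x.1} := by
    rw [Subtype.dense_iff]
    refine hdense.trans (closure_mono ?_)
    rintro x ⟨hxX, hx⟩
    exact ⟨⟨x, hxX⟩, hx, rfl⟩
  refine Continuous.ext_on hd (continuous_of_mem_McN hXc hf) (continuous_of_mem_McN hXc hg) ?_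
  intro x hx
  obtain ⟨y, rfl⟩ := hrange x hx
  rw [← hη y f hf, ← hη y g hg, hfg]
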